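/- For every ω > 0, the function Q_ω is smooth, positive and even on ℝ, and satisfies the ordinary differential equation Q_ω'' − Q_ω + Q_ω³ + ω·Q_ω⁵ = 0 on ℝ, together with the first integral (Q_ω')² − Q_ω² + (1/2)·Q_ω⁴ + (ω/3)·Q_ω⁶ = 0 on ℝ. -/

import Mathlib

open Real

/-- `a_ω = √(1 + 16ω/3)`. -/
noncomputable def aCoef (ω : ℝ) : ℝ := Real.sqrt (1 + 16 * ω / 3)

/-- The solitary wave profile `Q_ω(y) = √(4 / (1 + a_ω cosh 2y))`. -/
noncomputable def Q (ω : ℝ) (y : ℝ) : ℝ :=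
  Real.sqrt (4 / (1 + aCoef ω * Real.cosh (2 * y)))

lemma aCoef_sq {ω : ℝ} (hω : 0 ≤ ω) : aCoef ω ^ 2 = 1 + 16 * ω / 3 :=
  Real.sq_sqrt (by positivity)

lemma Q_denom_pos (ω y : ℝ) : 0 < 1 + aCoef ω * Real.cosh (2 * y) := by
  have ha : 0 ≤ aCoef ω := Real.sqrt_nonneg _
  have hc := Real.cosh_pos (2 * y)
  positivity

lemma Q_pos (ω y : ℝ) : 0 < Q ω y :=
  Real.sqrt_pos.2 (div_pos (by norm_num) (Q_denom_pos ω y))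

lemma Q_sq_mul_denom (ω y : ℝ) :
    Q ω y ^ 2 * (1 + aCoef ω * Real.cosh (2 * y)) = 4 := by
  have hD := Q_denom_pos ω y
  rw [Q, Real.sq_sqrt (by positivity), div_mul_cancel₀ _ hD.ne']

lemma contDiff_Q (ω : ℝ) {n : WithTop ℕ∞} : ContDiff ℝ n (Q ω) := by
  have hD : ContDiff ℝ n fun y : ℝ ↦ 1 + aCoef ω * Real.cosh (2 * y) :=
    contDiff_const.add
      (contDiff_const.mul (Real.contDiff_cosh.comp (contDiff_const.mul contDiff_id)))
  exact (contDiff_const.div hD fun y ↦ (Q_denom_pos ω y).ne').sqrt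
    fun y ↦ (div_pos (by norm_num) (Q_denom_pos ω y)).ne'

lemma hasDerivAt_cosh_two_mul (y : ℝ) :
    HasDerivAt (fun y ↦ Real.cosh (2 * y)) (2 * Real.sinh (2 * y)) y := by
  simpa [mul_comm] using ((hasDerivAt_id y).const_mul 2).cosh

lemma hasDerivAt_sinh_two_mul (y : ℝ) :
    HasDerivAt (fun y ↦ Real.sinh (2 * y)) (2 * Real.cosh (2 * y)) y := by
  simpa [mul_comm] using ((hasDerivAt_id y).const_mul 2).sinh

lemma hasDerivAt_Q (ω y : ℝ) :
    HasDerivAt (Q ω) (-(aCoef ω / 4) * (Real.sinh (2 * y) * Q ω y ^ 3)) y := by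
  have hQ : HasDerivAt (Q ω) (deriv (Q ω) y) y :=
    ((contDiff_Q ω (n := 1)).differentiable one_ne_zero y).hasDerivAt
  have hprod := (hQ.fun_pow 2).fun_mul
    (((hasDerivAt_cosh_two_mul y).const_mul (aCoef ω)).const_add 1)
  simp only [Q_sq_mul_denom] at hprod
  have hzero := hprod.unique (hasDerivAt_const y (4 : ℝ))
  norm_num at hzero
  have hD := Q_sq_mul_denom ω y
  convert hQ using 1
  linear_combination (-(Q ω y) / 8) * hzero + (deriv (Q ω) y / 4) * hD

lemma deriv_Q (ω : ℝ) :
    deriv (Q ω) = fun y ↦ -(aCoef ω / 4) * (Real.sinh (2 * y) * Q ω y ^ 3) :=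
  funext fun y ↦ (hasDerivAt_Q ω y).deriv

lemma deriv_deriv_Q (ω y : ℝ) :
    deriv (deriv (Q ω)) y = 3 * (aCoef ω * Real.sinh (2 * y) / 4) ^ 2 * Q ω y ^ 5
      - aCoef ω * Real.cosh (2 * y) / 2 * Q ω y ^ 3 := by
  rw [deriv_Q]
  refine (((hasDerivAt_sinh_two_mul y).fun_mul
    ((hasDerivAt_Q ω y).fun_pow 3)).const_mul _).deriv.trans ?_
  push_cast
  ring

/-- The square of `a_ω sinh 2y`, expressed through `Q_ω`. -/
lemma aCoef_mul_sinh_sq_mul_Q_pow_four {ω : ℝ} (hω : 0 ≤ ω) (y : ℝ) :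
    (aCoef ω * Real.sinh (2 * y)) ^ 2 * Q ω y ^ 4
      = 16 - 8 * Q ω y ^ 2 - 16 * ω / 3 * Q ω y ^ 4 := by
  have hD := Q_sq_mul_denom ω y
  linear_combination aCoef ω ^ 2 * Q ω y ^ 4 * Real.sinh_sq (2 * y)
    - Q ω y ^ 4 * aCoef_sq hω
    + (Q ω y ^ 2 * (1 + aCoef ω * Real.cosh (2 * y)) + 4 - 2 * Q ω y ^ 2) * hD

/-- The profile `Q_ω` is smooth, positive and even, solves
`Q'' - Q + Q³ + ω Q⁵ = 0`, and satisfies the first integral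
`(Q')² - Q² + Q⁴/2 + ω Q⁶/3 = 0`. -/
theorem Q_properties (ω : ℝ) (hω : 0 < ω) :
    ContDiff ℝ (⊤ : ℕ∞) (Q ω) ∧
    (∀ y : ℝ, 0 < Q ω y) ∧
    (∀ y : ℝ, Q ω (-y) = Q ω y) ∧
    (∀ y : ℝ, deriv (deriv (Q ω)) y - Q ω y + (Q ω y) ^ 3 + ω * (Q ω y) ^ 5 = 0) ∧
    (∀ y : ℝ, (deriv (Q ω) y) ^ 2 - (Q ω y) ^ 2 + (1 / 2) * (Q ω y) ^ 4
        + (ω / 3) * (Q ω y) ^ 6 = 0) := by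
  have hS := aCoef_mul_sinh_sq_mul_Q_pow_four hω.le
  refine ⟨contDiff_Q ω, Q_pos ω, fun y ↦ by simp [Q], fun y ↦ ?_, fun y ↦ ?_⟩
  · rw [deriv_deriv_Q]
    linear_combination 3 / 16 * Q ω y * hS y - Q ω y / 2 * Q_sq_mul_denom ω y
  · rw [deriv_Q]
    linear_combination Q ω y ^ 2 / 16 * hS y
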